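/- Let A be a separable unital C*-algebra and K ⊆ A a compact generating set. For every x ∈ A, the evaluation map x̂ : (Rep(A), d_K) → B(ℓ²), x̂(π) := π(x), is uniformly continuous: for every ε > 0 there exists δ > 0 such that for all π, π' ∈ Rep(A), d_K(π,π') < δ implies ‖π(x) − π'(x)‖ < ε. -/

import Mathlib

noncomputable section

abbrev H2 : Type := lp (fun _ : ℕ => ℂ) 2
abbrev BH : Type := H2 →L[ℂ] H2

abbrev RepSp (A : Type*) [CStarAlgebra A] := A →⋆ₐ[ℂ] BH

def Generates {A : Type*} [CStarAlgebra A] (K : Set A) : Prop :=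
  (StarAlgebra.adjoin ℂ K).topologicalClosure = ⊤

def dRep {A : Type*} [CStarAlgebra A] (K : Set A) (π₁ π₂ : RepSp A) : ℝ :=
  ⨆ a ∈ K, ‖π₁ a - π₂ a‖

open Filter Topology

section

variable {A : Type*} [CStarAlgebra A]

lemma norm_repSp_apply_le (π : RepSp A) (a : A) : ‖π a‖ ≤ ‖a‖ :=
  NonUnitalStarAlgHom.norm_apply_le π a

lemma norm_repSp_sub_le (π π' : RepSp A) (a : A) : ‖π a - π' a‖ ≤ 2 * ‖a‖ := by
  linarith [norm_sub_le (π a) (π' a), norm_repSp_apply_le π a, norm_repSp_apply_le π' a]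

lemma dRep_nonneg (K : Set A) (π π' : RepSp A) : 0 ≤ dRep K π π' :=
  Real.iSup_nonneg fun _ => Real.iSup_nonneg fun _ => norm_nonneg _

lemma norm_sub_le_dRep {K : Set A} (hK : IsCompact K) {a : A} (ha : a ∈ K) (π π' : RepSp A) :
    ‖π a - π' a‖ ≤ dRep K π π' := by
  obtain ⟨C, hC⟩ := hK.isBounded.exists_norm_le
  have hC0 : 0 ≤ C := (norm_nonneg a).trans (hC a ha)
  have hbdd : BddAbove (Set.range fun b => ⨆ _ : b ∈ K, ‖π b - π' b‖) := by
    refine ⟨2 * C, ?_⟩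
    rintro _ ⟨b, rfl⟩
    refine Real.iSup_le (fun hb => ?_) (by positivity)
    linarith [norm_repSp_sub_le π π' b, hC b hb]
  calc ‖π a - π' a‖ = ⨆ _ : a ∈ K, ‖π a - π' a‖ := (ciSup_pos (f := fun _ => _) ha).symm
    _ ≤ dRep K π π' := le_ciSup hbdd a

/-- The elements whose evaluation maps agree asymptotically along `F` form a closed star subalgebra,
so they exhaust `A` as soon as they contain a generating set. -/
lemma tendsto_repSp_sub {K : Set A} (hgen : Generates K) {F : Filter (RepSp A × RepSp A)}
    (hF : ∀ a ∈ K, Tendsto (fun p : RepSp A × RepSp A => p.1 a - p.2 a) F (𝓝 0)) (x : A) :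
    Tendsto (fun p : RepSp A × RepSp A => p.1 x - p.2 x) F (𝓝 0) := by
  have hadjoin : ∀ y ∈ StarAlgebra.adjoin ℂ K,
      Tendsto (fun p : RepSp A × RepSp A => p.1 y - p.2 y) F (𝓝 0) := by
    intro y hy
    induction hy using StarAlgebra.adjoin_induction with
    | mem a ha => exact hF a ha
    | algebraMap r => simp [AlgHomClass.commutes, tendsto_const_nhds]
    | add a b _ _ ha hb => simpa [add_sub_add_comm] using ha.add hb
    | mul a b _ _ ha hb =>
      have hlim : Tendsto (fun p : RepSp A × RepSp A =>
          ‖a‖ * ‖p.1 b - p.2 b‖ + ‖p.1 a - p.2 a‖ * ‖b‖) F (𝓝 0) := by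
        simpa using (hb.norm.const_mul ‖a‖).add (ha.norm.mul_const ‖b‖)
      refine squeeze_zero_norm (fun p => ?_) hlim
      calc ‖p.1 (a * b) - p.2 (a * b)‖
          = ‖p.1 a * (p.1 b - p.2 b) + (p.1 a - p.2 a) * p.2 b‖ := by
            rw [map_mul, map_mul]; congr 1; noncomm_ring
        _ ≤ ‖p.1 a‖ * ‖p.1 b - p.2 b‖ + ‖p.1 a - p.2 a‖ * ‖p.2 b‖ :=
            norm_add_le_of_le (norm_mul_le _ _) (norm_mul_le _ _)
        _ ≤ ‖a‖ * ‖p.1 b - p.2 b‖ + ‖p.1 a - p.2 a‖ * ‖b‖ := by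
            gcongr <;> exact norm_repSp_apply_le _ _
    | star a _ ha => simpa [map_star] using ha.star
  have hx : x ∈ closure (StarAlgebra.adjoin ℂ K : Set A) := by
    rw [← StarSubalgebra.topologicalClosure_coe, hgen]
    trivial
  rw [Metric.tendsto_nhds]
  intro ε hε
  obtain ⟨y, hy, hxy⟩ := Metric.mem_closure_iff.1 hx (ε / 4) (by positivity)
  filter_upwards [Metric.tendsto_nhds.1 (hadjoin y hy) (ε / 2) (by positivity)] with p hp
  rw [dist_zero_right] at hp ⊢
  rw [dist_eq_norm] at hxy
  have hsplit : p.1 x - p.2 x = (p.1 (x - y) - p.2 (x - y)) + (p.1 y - p.2 y) := by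
    rw [map_sub, map_sub]; abel
  rw [hsplit]
  linarith [norm_add_le (p.1 (x - y) - p.2 (x - y)) (p.1 y - p.2 y),
    norm_repSp_sub_le p.1 p.2 (x - y)]

end

theorem stmt4 (A : Type*) [CStarAlgebra A] [TopologicalSpace.SeparableSpace A]
    (K : Set A) (hK : IsCompact K) (hgen : Generates K) (x : A) :
    ∀ ε > (0 : ℝ), ∃ δ > (0 : ℝ), ∀ π π' : RepSp A,
      dRep K π π' < δ → ‖π x - π' x‖ < ε := by
  intro ε hε
  let F : Filter (RepSp A × RepSp A) := comap (fun p => dRep K p.1 p.2) (𝓝 0)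
  have hF : ∀ a ∈ K, Tendsto (fun p : RepSp A × RepSp A => p.1 a - p.2 a) F (𝓝 0) := fun a ha =>
    squeeze_zero_norm (fun p => norm_sub_le_dRep hK ha p.1 p.2) tendsto_comap
  have hev := Metric.tendsto_nhds.1 (tendsto_repSp_sub hgen hF x) ε hε
  obtain ⟨δ, hδ, h⟩ := ((Metric.nhds_basis_ball.comap _).eventually_iff).1 hev
  refine ⟨δ, hδ, fun π π' hππ' => ?_⟩
  have hmem : (π, π') ∈ (fun p : RepSp A × RepSp A => dRep K p.1 p.2) ⁻¹' Metric.ball 0 δ := by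
    simpa [abs_of_nonneg (dRep_nonneg K π π')] using hππ'
  simpa only [dist_zero_right] using h hmem
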